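/- No coordinated protocol for the bit-exchange task that is resilient to an unbounded amount of erasures has coordinated-termination at round 1 or at round 2. That is, for any such protocol Π, there do not exist inputs (x,y) ∈ {0,1}² and a finite noise pattern P such that in the execution Π(x,y‖P) both parties terminate at round 1, nor such that both parties terminate at round 2. -/

import Mathlib

/-!
Model of two-party deterministic alternating protocols for the bit-exchange task over
an erasure channel (Appendix A of "Interactive coding resilient to an unknown number
of erasures").  Alice holds a bit `x`, Bob a bit `y`; Alice sends in odd rounds and
Bob in even rounds.  A reception is `none` (the erasure mark ⊥), `some none` (silence
`□`, heard when the partner has already terminated), or `some (some a)` for a channel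
symbol `a`.  A party's behaviour at each round is a deterministic function of its
input and its reception history: what it sends (when it is the sender), whether it
terminates at that round, and, upon termination, its output bit.
A noise pattern `P : ℕ → Bool` tells which rounds' transmissions are erased.
-/

namespace BitExchange

/-- A reception: `none` = erasure mark ⊥, `some none` = silence `□`,
`some (some a)` = channel symbol `a`. -/
abbrev Rcv (S : Type) := Option (Option S)

/-- A deterministic alternating bit-exchange protocol over channel alphabet `S`. -/
structure Protocol (S : Type) where
  /-- The symbol Alice sends, given her input and reception history. -/
  aSend : Bool → List (Rcv S) → S
  /-- Whether Alice terminates at the given round, as a function of her view. -/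
  aHalt : Bool → ℕ → List (Rcv S) → Bool
  /-- Alice's output upon termination. -/
  aOut : Bool → ℕ → List (Rcv S) → Bool
  /-- The symbol Bob sends, given his input and reception history. -/
  bSend : Bool → List (Rcv S) → S
  /-- Whether Bob terminates at the given round, as a function of his view. -/
  bHalt : Bool → ℕ → List (Rcv S) → Bool
  /-- Bob's output upon termination. -/
  bOut : Bool → ℕ → List (Rcv S) → Bool

/-- Execution state after some number of rounds: the parties' reception histories and
their termination rounds (if they have terminated). -/
structure ExSt (S : Type) where
  aH : List (Rcv S)
  bH : List (Rcv S)
  aD : Option ℕ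
  bD : Option ℕ

/-- The initial execution state. -/
def initEx (S : Type) : ExSt S := ⟨[], [], none, none⟩

/-- One round of the execution of protocol `Pr` on inputs `x, y` with noise pattern
`P` (round `r`; odd rounds: Alice sends, Bob receives; even rounds vice versa; a
terminated sender is heard as silence `□`; at the end of the round each still-active
party terminates if its halting predicate holds on its current view). -/
def stepEx {S : Type} (Pr : Protocol S) (x y : Bool) (P : ℕ → Bool) (r : ℕ)
    (s : ExSt S) : ExSt S :=
  if r % 2 = 1 then
    let rcv : Rcv S :=
      if P r then none
      else if s.aD.isSome then some none else some (some (Pr.aSend x s.aH))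
    let bH' := s.bH ++ [rcv]
    { aH := s.aH, bH := bH',
      aD := if s.aD.isSome then s.aD else if Pr.aHalt x r s.aH then some r else none,
      bD := if s.bD.isSome then s.bD else if Pr.bHalt y r bH' then some r else none }
  else
    let rcv : Rcv S :=
      if P r then none
      else if s.bD.isSome then some none else some (some (Pr.bSend y s.bH))
    let aH' := s.aH ++ [rcv]
    { aH := aH', bH := s.bH,
      aD := if s.aD.isSome then s.aD else if Pr.aHalt x r aH' then some r else none,
      bD := if s.bD.isSome then s.bD else if Pr.bHalt y r s.bH then some r else none }

/-- The execution state of `Π(x,y‖P)` after `r` rounds. -/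
def exAt {S : Type} (Pr : Protocol S) (x y : Bool) (P : ℕ → Bool) : ℕ → ExSt S
  | 0 => initEx S
  | r + 1 => stepEx Pr x y P (r + 1) (exAt Pr x y P r)

/-- Alice terminates at round `i` in the execution `Π(x,y‖P)`. -/
def aliceTermAt {S : Type} (Pr : Protocol S) (x y : Bool) (P : ℕ → Bool) (i : ℕ) :
    Prop :=
  (exAt Pr x y P i).aD = some i

/-- Bob terminates at round `i` in the execution `Π(x,y‖P)`. -/
def bobTermAt {S : Type} (Pr : Protocol S) (x y : Bool) (P : ℕ → Bool) (i : ℕ) :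
    Prop :=
  (exAt Pr x y P i).bD = some i

/-- A noise pattern is finite if it erases only finitely many rounds. -/
def FiniteNoise (P : ℕ → Bool) : Prop := ∃ n, ∀ m, n ≤ m → P m = false

/-- `Pr` is resilient to an unbounded amount of erasures: on every pair of inputs and
every finite noise pattern, both parties terminate and output the other party's bit. -/
def Resilient {S : Type} (Pr : Protocol S) : Prop :=
  ∀ x y : Bool, ∀ P : ℕ → Bool, FiniteNoise P →
    (∃ i, aliceTermAt Pr x y P i ∧ Pr.aOut x i (exAt Pr x y P i).aH = y) ∧
    (∃ j, bobTermAt Pr x y P j ∧ Pr.bOut y j (exAt Pr x y P j).bH = x)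

/-- `Pr` is coordinated: in every execution (any inputs, any finite noise pattern)
Alice and Bob terminate at the same round. -/
def Coordinated {S : Type} (Pr : Protocol S) : Prop :=
  ∀ x y : Bool, ∀ P : ℕ → Bool, FiniteNoise P → ∀ i j,
    aliceTermAt Pr x y P i → bobTermAt Pr x y P j → i = j

/-- `Pr` has coordinated-termination at round `i`: some inputs and some finite noise
pattern make both parties terminate at round `i`. -/
def CoordTermAt {S : Type} (Pr : Protocol S) (i : ℕ) : Prop :=
  ∃ x y : Bool, ∃ P : ℕ → Bool, FiniteNoise P ∧
    aliceTermAt Pr x y P i ∧ bobTermAt Pr x y P i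

/-- Once Alice has terminated, her recorded termination round never changes. -/
theorem aD_eq_of_le {S : Type} (Pr : Protocol S) (x y : Bool) (P : ℕ → Bool) {i r k : ℕ}
    (hrk : r ≤ k) (h : (exAt Pr x y P r).aD = some i) : (exAt Pr x y P k).aD = some i := by
  induction k, hrk using Nat.le_induction with
  | base => exact h
  | succ k _ ih =>
    simp only [exAt, stepEx]
    split <;> simp [ih]

/-- Alice terminates at no more than one round of an execution. -/
theorem aliceTermAt_unique {S : Type} (Pr : Protocol S) {x y : Bool} {P : ℕ → Bool} {i j : ℕ}
    (hi : aliceTermAt Pr x y P i) (hj : aliceTermAt Pr x y P j) : i = j := by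
  have h₁ := aD_eq_of_le Pr x y P (le_max_left i j) hi
  have h₂ := aD_eq_of_le Pr x y P (le_max_right i j) hj
  exact Option.some.inj (h₁.symm.trans h₂)

/-- In a resilient protocol, Alice's view at her termination round determines Bob's bit. -/
theorem Resilient.bob_input_eq {S : Type} {Pr : Protocol S} (hres : Resilient Pr)
    {x y y' : Bool} {P P' : ℕ → Bool} (hP : FiniteNoise P) (hP' : FiniteNoise P') {i : ℕ}
    (h : aliceTermAt Pr x y P i) (h' : aliceTermAt Pr x y' P' i)
    (hview : (exAt Pr x y P i).aH = (exAt Pr x y' P' i).aH) : y = y' := by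
  obtain ⟨⟨j, hj, hout⟩, -⟩ := hres x y P hP
  obtain ⟨⟨j', hj', hout'⟩, -⟩ := hres x y' P' hP'
  obtain rfl := aliceTermAt_unique Pr h hj
  obtain rfl := aliceTermAt_unique Pr h' hj'
  rw [← hout, ← hout', hview]

/-- Claim 24 of the paper.  No coordinated protocol for the
bit-exchange task that is resilient to an unbounded amount of erasures has
coordinated-termination at round `1` or at round `2`. -/
theorem no_coordinated_termination_at_rounds_one_or_two
    {S : Type} (Pr : Protocol S)
    (hres : Resilient Pr) (hcoord : Coordinated Pr) :
    ¬ CoordTermAt Pr 1 ∧ ¬ CoordTermAt Pr 2 := by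
  constructor
  · rintro ⟨x, y, P, hP, hA, -⟩
    have hA' : aliceTermAt Pr x (!y) P 1 := by
      simpa [aliceTermAt, exAt, stepEx, initEx] using hA
    have := hres.bob_input_eq hP hP hA hA' (by simp [exAt, stepEx, initEx])
    simp at this
  · rintro ⟨x, y, P, ⟨n, hn⟩, -, hB⟩
    -- Erasing round 2 does not change Bob's view at round 2.
    set Q : ℕ → Bool := Function.update P 2 true with hQ
    have hQfin : FiniteNoise Q :=
      ⟨max n 3, fun m hm => by
        rw [hQ, Function.update_of_ne (by omega)]
        exact hn m (by omega)⟩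
    have hBQ : bobTermAt Pr x y Q 2 := by
      simpa [bobTermAt, exAt, stepEx, initEx, hQ] using hB
    obtain ⟨⟨i, hi, -⟩, -⟩ := hres x y Q hQfin
    obtain rfl := hcoord x y Q hQfin i 2 hi hBQ
    have hA' : aliceTermAt Pr x (!y) Q 2 := by
      simpa [aliceTermAt, exAt, stepEx, initEx, hQ] using hi
    have := hres.bob_input_eq hQfin hQfin hi hA' (by simp [exAt, stepEx, initEx, hQ])
    simp at this

end BitExchange
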